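/- Let Γ be a finite connected simple graph containing no cycles of length 3 or 4 which is not a tree, with ℓ leaves and π pieces. Then Out(A_Γ) contains a free abelian subgroup of rank π + 2ℓ − 1. (This is the lower bound in the theorem that π + 2ℓ − 1 ≤ vcd(Out(A_Γ)) ≤ π + 2ℓ − 1 − 2χ(Γ).) -/

import Mathlib

/-- The relators of a right-angled Artin group: commutators of adjacent generators. -/
def raagRels {V : Type*} (Γ : SimpleGraph V) : Set (FreeGroup V) :=
  {r | ∃ v w : V, Γ.Adj v w ∧
    r = FreeGroup.of v * FreeGroup.of w * (FreeGroup.of v)⁻¹ * (FreeGroup.of w)⁻¹}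

/-- The right-angled Artin group of a simple graph. -/
abbrev RAAG {V : Type*} (Γ : SimpleGraph V) : Type _ := PresentedGroup (raagRels Γ)

/-- The generator of `RAAG Γ` corresponding to a vertex. -/
def raagGen {V : Type*} (Γ : SimpleGraph V) (v : V) : RAAG Γ := PresentedGroup.of v

instance innerAutNormal (G : Type*) [Group G] :
    ((MulAut.conj : G →* MulAut G).range).Normal := by
  constructor
  intro x hx φ
  obtain ⟨g, rfl⟩ := hx
  refine ⟨φ g, ?_⟩
  ext y
  simp [MulAut.conj]

abbrev OutG (G : Type*) [Group G] : Type _ :=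
  MulAut G ⧸ ((MulAut.conj : G →* MulAut G).range)

def outMk (G : Type*) [Group G] : MulAut G →* OutG G :=
  QuotientGroup.mk' _

/-- `v` is a leaf: it has exactly one neighbor. -/
def IsLeaf {V : Type*} (Γ : SimpleGraph V) (v : V) : Prop :=
  (Γ.neighborSet v).ncard = 1

/-- The number of leaves. -/
noncomputable def numLeaves {V : Type*} (Γ : SimpleGraph V) : ℕ :=
  {v | IsLeaf Γ v}.ncard

/-- A subgraph has no separating vertex: deleting any of its vertices leaves it connected. -/
def NoCutVertex {V : Type*} {Γ : SimpleGraph V} (H : Γ.Subgraph) : Prop :=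
  ∀ v ∈ H.verts, (H.deleteVerts {v}).Connected

/-- A piece (block) of `Γ`: a maximal connected subgraph with at least one edge
having no separating vertex (a single edge counts as a piece). -/
def IsPiece {V : Type*} (Γ : SimpleGraph V) (H : Γ.Subgraph) : Prop :=
  H.Connected ∧ H.edgeSet.Nonempty ∧ NoCutVertex H ∧
    ∀ H' : Γ.Subgraph, H'.Connected → H'.edgeSet.Nonempty → NoCutVertex H' →
      H ≤ H' → H' = H

/-- The number of pieces of `Γ`. -/
noncomputable def numPieces {V : Type*} (Γ : SimpleGraph V) : ℕ :=
  Nat.card {H : Γ.Subgraph // IsPiece Γ H}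

/-- `u` and `w` are connected by a walk in `Γ` avoiding the vertex `v`
(i.e. they lie in the same connected component of `Γ ∖ {v}`). -/
def ReachAvoid {V : Type*} (Γ : SimpleGraph V) (v u w : V) : Prop :=
  ∃ p : Γ.Walk u w, v ∉ p.support

/-- There is an injective homomorphism from the free abelian group of rank `r` into `G`. -/
def HasFreeAbelianSubgroupOfRank (G : Type*) [Group G] (r : ℕ) : Prop :=
  ∃ f : Multiplicative (Fin r →₀ ℤ) →* G, Function.Injective f

/-- A criterion for a commuting family of one-parameter groups of automorphisms to generate a free
abelian subgroup of the outer automorphism group: every parameter is detected, modulo those of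
smaller rank, by a family of representations stable under the other one-parameter groups. -/
theorem hasFreeAbelianSubgroupOfRank_outG {A ι : Type*} [Group A] [Fintype ι] {r : ℕ}
    (hr : r ≤ Fintype.card ι) (D : ι → Multiplicative ℤ →* MulAut A)
    (hcomm : Pairwise fun i j => ∀ m n, Commute (D i m) (D j n)) (rk : ι → ℕ)
    (hdet : ∀ i, ∃ (G : Type) (_ : Group G) (ρ : A →* G) (R : Set (A →* G)), ρ ∈ R ∧
      (∀ j ≠ i, rk i ≤ rk j → ∀ n, ∀ σ ∈ R, σ.comp (D j n).toMonoidHom ∈ R) ∧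
      ∀ σ ∈ R, ∀ n g, (∀ a, σ (D i n a) = ρ (g * a * g⁻¹)) → n = 1) :
    HasFreeAbelianSubgroupOfRank (OutG A) r := by
  classical
  let F : (ι → Multiplicative ℤ) →* MulAut A := MonoidHom.noncommPiCoprod D hcomm
  have key : ∀ m, F m ∈ (MulAut.conj : A →* MulAut A).range → m = 1 := by
    rintro m ⟨g, hg⟩
    suffices h : ∀ k i, rk i = k → m i = 1 from funext fun i => h _ i rfl
    intro k
    induction k using Nat.strong_induction_on with
    | _ k ih =>
    rintro i rfl
    obtain ⟨G, _, ρ, R, hρ, hR, hinj⟩ := hdet i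
    have hsplit : m = Function.update m i 1 * Pi.mulSingle i (m i) := by
      ext j
      by_cases h : j = i
      · subst h; simp
      · simp [h]
    have hrest : ∀ σ ∈ R, σ.comp (F (Function.update m i 1)).toMonoidHom ∈ R := by
      rw [MonoidHom.noncommPiCoprod_apply]
      apply Finset.noncommProd_induction _ _ _
        (fun ψ : MulAut A => ∀ σ ∈ R, σ.comp ψ.toMonoidHom ∈ R)
      · intro ψ₁ ψ₂ h₁ h₂ σ hσ
        exact h₂ _ (h₁ σ hσ)
      · intro σ hσ
        exact hσ
      · intro j _ σ hσ
        by_cases hj : j = i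
        · subst hj
          rw [Function.update_self, map_one]
          exact hσ
        · by_cases hk : rk i ≤ rk j
          · exact hR j hj hk _ σ hσ
          · rw [Function.update_of_ne hj, ih _ (not_le.mp hk) j rfl, map_one]
            exact hσ
    refine hinj _ (hrest ρ hρ) (m i) g fun a => ?_
    have : F m = F (Function.update m i 1) * D i (m i) := by
      conv_lhs => rw [hsplit]
      rw [map_mul, MonoidHom.noncommPiCoprod_mulSingle]
    have h2 := congrArg (fun ψ : MulAut A => ρ (ψ a)) (this.symm.trans hg.symm)
    simpa using h2
  let e : Fin r ↪ ι :=
    (Fin.castLEEmb hr).trans (Fintype.equivFin ι).symm.toEmbedding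
  let E : Multiplicative (Fin r →₀ ℤ) →* (ι → Multiplicative ℤ) :=
    { toFun := fun z i => Multiplicative.ofAdd ((Multiplicative.toAdd z).embDomain e i)
      map_one' := by ext; simp
      map_mul' := fun z w => by
        ext i
        simp [← ofAdd_add, Finsupp.embDomain_add] }
  refine ⟨(outMk A).comp (F.comp E), (injective_iff_map_eq_one _).mpr fun z hz => ?_⟩
  have h1 : F (E z) ∈ (MulAut.conj : A →* MulAut A).range :=
    (QuotientGroup.eq_one_iff _).mp hz
  have h2 := key _ h1
  apply Multiplicative.toAdd.injective
  ext k
  have h3 := congrFun h2 (e k)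
  simpa [E] using h3

theorem commute_raagGen {V : Type*} {Γ : SimpleGraph V} {v w : V} (h : Γ.Adj v w) :
    Commute (raagGen Γ v) (raagGen Γ w) := by
  have h1 : (PresentedGroup.mk (raagRels Γ)) (FreeGroup.of v * FreeGroup.of w *
      (FreeGroup.of v)⁻¹ * (FreeGroup.of w)⁻¹) = 1 :=
    PresentedGroup.one_of_mem ⟨v, w, h, rfl⟩
  simp only [map_mul, map_inv] at h1
  have h2 := mul_inv_eq_iff_eq_mul.mp h1
  rw [one_mul, mul_inv_eq_iff_eq_mul] at h2
  exact h2

/-- The universal property of a right-angled Artin group. -/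
def raagLift {V G : Type*} [Group G] (Γ : SimpleGraph V) (f : V → G)
    (hf : ∀ v w, Γ.Adj v w → Commute (f v) (f w)) : RAAG Γ →* G :=
  PresentedGroup.toGroup (f := f) <| by
    rintro _ ⟨v, w, h, rfl⟩
    simp [(hf v w h).eq]

@[simp]
theorem raagLift_gen {V G : Type*} [Group G] (Γ : SimpleGraph V) (f : V → G)
    (hf : ∀ v w, Γ.Adj v w → Commute (f v) (f w)) (v : V) :
    raagLift Γ f hf (raagGen Γ v) = f v :=
  PresentedGroup.toGroup.of _

theorem raag_hom_ext {V G : Type*} [Group G] {Γ : SimpleGraph V} {φ ψ : RAAG Γ →* G}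
    (h : ∀ v, φ (raagGen Γ v) = ψ (raagGen Γ v)) : φ = ψ :=
  PresentedGroup.ext h

/-- Data for the automorphisms `t ↦ x ^ (n * left t) * t * x ^ (n * right t)` of a right-angled
Artin group, where `x = mult` is a fixed generator. -/
structure Twist {V : Type*} (Γ : SimpleGraph V) where
  mult : V
  left : V → ℤ
  right : V → ℤ
  left_mult : left mult = 0
  right_mult : right mult = 0
  compat : ∀ s t, Γ.Adj s t → (left s = left t ∧ right s = -left s ∧ right t = -left t) ∨
    (left t = 0 ∧ right t = 0 ∧ Commute (raagGen Γ t) (raagGen Γ mult)) ∨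
    (left s = 0 ∧ right s = 0 ∧ Commute (raagGen Γ s) (raagGen Γ mult))

namespace Twist

variable {V : Type*} {Γ : SimpleGraph V} (T T' : Twist Γ)

/-- The endomorphism with parameter `n` attached to a twist. -/
def endo (n : ℤ) : RAAG Γ →* RAAG Γ :=
  raagLift Γ (fun t => raagGen Γ T.mult ^ (n * T.left t) * raagGen Γ t *
      raagGen Γ T.mult ^ (n * T.right t)) <| by
    intro s t hst
    have hc := commute_raagGen hst
    rcases T.compat s t hst with ⟨h1, h2, h3⟩ | ⟨h1, h2, h3⟩ | ⟨h1, h2, h3⟩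
    · rw [h2, h3, h1]
      simp only [mul_neg, zpow_neg]
      exact hc.conj _
    · simp only [h1, h2, mul_zero, zpow_zero, one_mul, mul_one]
      exact ((h3.symm.zpow_left _).mul_left hc).mul_left (h3.symm.zpow_left _)
    · simp only [h1, h2, mul_zero, zpow_zero, one_mul, mul_one]
      exact ((h3.zpow_right _).mul_right hc).mul_right (h3.zpow_right _)

@[simp]
theorem endo_gen (n : ℤ) (t : V) : T.endo n (raagGen Γ t) =
    raagGen Γ T.mult ^ (n * T.left t) * raagGen Γ t * raagGen Γ T.mult ^ (n * T.right t) :=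
  raagLift_gen ..

theorem endo_add (m n : ℤ) : T.endo (m + n) = (T.endo m).comp (T.endo n) := by
  refine raag_hom_ext fun t => ?_
  simp [T.left_mult, T.right_mult, add_mul, zpow_add, mul_assoc]
  group

theorem endo_zero : T.endo 0 = MonoidHom.id _ := by
  refine raag_hom_ext fun t => ?_
  simp

/-- The one-parameter group of automorphisms attached to a twist. -/
def aut : Multiplicative ℤ →* MulAut (RAAG Γ) where
  toFun n := MonoidHom.toMulEquiv (T.endo n.toAdd) (T.endo (-n.toAdd))
    (by rw [← endo_add]; simp [endo_zero]) (by rw [← endo_add]; simp [endo_zero])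
  map_one' := by ext a; simp [endo_zero]
  map_mul' m n := by ext a; simp [endo_add]

theorem aut_apply (n : Multiplicative ℤ) (a : RAAG Γ) : T.aut n a = T.endo n.toAdd a := rfl

theorem commute_aut_of_endo (h : ∀ m n t, T.endo m (T'.endo n (raagGen Γ t)) =
    T'.endo n (T.endo m (raagGen Γ t))) (m n : Multiplicative ℤ) :
    Commute (T.aut m) (T'.aut n) := by
  have : (T.endo m.toAdd).comp (T'.endo n.toAdd) = (T'.endo n.toAdd).comp (T.endo m.toAdd) :=
    raag_hom_ext fun t => h _ _ t
  ext a
  exact DFunLike.congr_fun this a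

/-- Two twists which fix each other's multipliers commute if, wherever both of them act
nontrivially, their multipliers commute. -/
theorem commute_aut_of_fixed (hl : T.left T'.mult = 0) (hr : T.right T'.mult = 0)
    (hl' : T'.left T.mult = 0) (hr' : T'.right T.mult = 0)
    (h : ∀ t, Commute (raagGen Γ T.mult) (raagGen Γ T'.mult) ∨
      (T.left t = 0 ∧ T.right t = 0) ∨ (T'.left t = 0 ∧ T'.right t = 0))
    (m n : Multiplicative ℤ) : Commute (T.aut m) (T'.aut n) := by
  refine commute_aut_of_endo _ _ (fun m n t => ?_) m n
  simp only [endo_gen, map_mul, map_zpow, hl, hr, hl', hr', mul_zero, zpow_zero, one_mul, mul_one]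
  rcases h t with h | ⟨h1, h2⟩ | ⟨h1, h2⟩
  · have e1 := ((h.zpow_zpow (m * T.left t) (n * T'.left t))).eq
    have e2 := ((h.zpow_zpow (m * T.right t) (n * T'.right t))).eq
    simp only [mul_assoc]
    rw [e2]
    simp only [← mul_assoc]
    rw [e1]
  · simp [h1, h2]
  · simp [h1, h2]

/-- A twist `T` commutes with a twist `T'` fixing its multiplier if `T` conjugates the
multiplier of `T'` and all generators moved by `T'` by the same element. -/
theorem commute_aut_of_nested (hl' : T'.left T.mult = 0) (hr' : T'.right T.mult = 0)
    (hx : T.right T'.mult = -T.left T'.mult)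
    (h : ∀ t, (T'.left t = 0 ∧ T'.right t = 0) ∨
      (T.left t = T.left T'.mult ∧ T.right t = -T.left T'.mult))
    (m n : Multiplicative ℤ) : Commute (T.aut m) (T'.aut n) := by
  refine commute_aut_of_endo _ _ (fun m n t => ?_) m n
  simp only [endo_gen, map_mul, map_zpow, hl', hr', mul_zero, zpow_zero, one_mul, mul_one]
  rcases h t with ⟨h1, h2⟩ | ⟨h1, h2⟩
  · simp [h1, h2]
  · rw [h1, h2, hx]
    simp only [mul_neg, zpow_neg, conj_zpow]
    group

end Twist

/-- Branches of a graph: sets of vertices separated from the rest by a single vertex, their gate.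
Every vertex has a chosen neighbor `dir v`, lying outside of all branches with gate `v`. -/
structure BranchSystem {V : Type*} (Γ : SimpleGraph V) (J : Type*) where
  gate : J → V
  start : J → V
  branch : J → Set V
  dir : V → V
  closed : ∀ P a b, a ∈ branch P → Γ.Adj a b → b = gate P ∨ b ∈ branch P
  gate_notMem : ∀ P, gate P ∉ branch P
  start_mem : ∀ P, start P ∈ branch P
  adj_start : ∀ P, Γ.Adj (gate P) (start P)
  adj_dir : ∀ v, Γ.Adj v (dir v)
  dir_notMem : ∀ P, dir (gate P) ∉ branch P
  disjoint_of_gate_eq : ∀ P Q, gate P = gate Q → P ≠ Q → Disjoint (branch P) (branch Q)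
  disjoint_of_gate_ne : ∀ P Q, gate P ≠ gate Q → gate Q ∉ branch P → gate P ∉ branch Q →
    Disjoint (branch P) (branch Q)
  nested : ∀ P Q, gate Q ∈ branch P → branch Q ⊆ branch P ∧ gate P ∉ branch Q
  gate_not_leaf : ∀ P, ¬ IsLeaf Γ (gate P)
  dir_not_leaf : ∀ v, ¬ IsLeaf Γ (dir v)
  not_leaf_of_adj : ∀ u w, IsLeaf Γ u → Γ.Adj u w → ¬ IsLeaf Γ w
  exists_core : ∀ v, ∃ c, ¬ IsLeaf Γ c ∧ c ≠ v ∧ ¬ Γ.Adj c v ∧ ∀ P, c ∉ branch P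

theorem IsLeaf.exists_adj {V : Type*} {Γ : SimpleGraph V} {u : V} (h : IsLeaf Γ u) :
    ∃ w, ∀ t, Γ.Adj u t ↔ t = w := by
  obtain ⟨w, hw⟩ := Set.ncard_eq_one.mp h
  exact ⟨w, fun t => by simpa using Set.ext_iff.mp hw t⟩

/-- The neighbor of a leaf. -/
noncomputable def leafNbr {V : Type*} (Γ : SimpleGraph V) (u : {u : V // IsLeaf Γ u}) : V :=
  u.2.exists_adj.choose

theorem adj_leaf_iff {V : Type*} {Γ : SimpleGraph V} (u : {u : V // IsLeaf Γ u}) (t : V) :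
    Γ.Adj u t ↔ t = leafNbr Γ u :=
  u.2.exists_adj.choose_spec t

namespace BranchSystem

variable {V J : Type*} {Γ : SimpleGraph V} (B : BranchSystem Γ J)

open Classical in
/-- Conjugation of the branch `P` by the chosen neighbor of its gate. -/
noncomputable def conjTwist (P : J) : Twist Γ where
  mult := B.dir (B.gate P)
  left t := if t ∈ B.branch P then 1 else 0
  right t := if t ∈ B.branch P then -1 else 0
  left_mult := if_neg (B.dir_notMem P)
  right_mult := if_neg (B.dir_notMem P)
  compat s t hst := by
    have hc := commute_raagGen (B.adj_dir (B.gate P))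
    by_cases hs : s ∈ B.branch P <;> by_cases ht : t ∈ B.branch P
    · simp [hs, ht]
    · obtain rfl := (B.closed P s t hs hst).resolve_right ht
      simp [hs, ht, hc]
    · obtain rfl := (B.closed P t s ht hst.symm).resolve_right hs
      simp [hs, ht, hc]
    · simp [hs, ht]

/-- The two multipliers of a leaf: its neighbor `w` and the chosen neighbor of `w`. -/
noncomputable def leafMult (i : {u : V // IsLeaf Γ u} × Bool) : V :=
  bif i.2 then leafNbr Γ i.1 else B.dir (leafNbr Γ i.1)

theorem leafMult_not_leaf (i : {u : V // IsLeaf Γ u} × Bool) : ¬ IsLeaf Γ (B.leafMult i) := by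
  obtain ⟨u, _ | _⟩ := i
  · exact B.dir_not_leaf _
  · exact B.not_leaf_of_adj _ _ u.2 ((adj_leaf_iff u _).mpr rfl)

theorem leafMult_eq_or (i : {u : V // IsLeaf Γ u} × Bool) :
    B.leafMult i = leafNbr Γ i.1 ∨ B.leafMult i = B.dir (leafNbr Γ i.1) := by
  obtain ⟨u, _ | _⟩ := i
  · exact Or.inr rfl
  · exact Or.inl rfl

theorem commute_leafMult (i : {u : V // IsLeaf Γ u} × Bool) :
    Commute (raagGen Γ (leafNbr Γ i.1)) (raagGen Γ (B.leafMult i)) := by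
  rcases B.leafMult_eq_or i with h | h <;> rw [h]
  exact commute_raagGen (B.adj_dir _)

theorem commute_leafMult_leafMult (u : {u : V // IsLeaf Γ u}) (b b' : Bool) :
    Commute (raagGen Γ (B.leafMult (u, b))) (raagGen Γ (B.leafMult (u, b'))) := by
  have h := commute_raagGen (B.adj_dir (leafNbr Γ u))
  cases b <;> cases b' <;> first | exact Commute.refl _ | exact h | exact h.symm

theorem leafMult_ne (u : {u : V // IsLeaf Γ u}) {b b' : Bool} (h : b ≠ b') :
    B.leafMult (u, b) ≠ B.leafMult (u, b') := by
  have hne := (B.adj_dir (leafNbr Γ u)).ne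
  cases b <;> cases b' <;> first | contradiction | exact hne | exact hne.symm

open Classical in
/-- The transvection multiplying a leaf on the right by one of its multipliers. -/
noncomputable def leafTwist (i : {u : V // IsLeaf Γ u} × Bool) : Twist Γ where
  mult := B.leafMult i
  left _ := 0
  right t := if t = i.1 then 1 else 0
  left_mult := rfl
  right_mult := if_neg fun h : B.leafMult i = i.1 => B.leafMult_not_leaf i (h ▸ i.1.2)
  compat s t hst := by
    have hc := B.commute_leafMult i
    by_cases hs : s = i.1
    · obtain rfl : t = _ := (adj_leaf_iff i.1 t).mp (hs ▸ hst)
      have ht : leafNbr Γ i.1 ≠ i.1 := fun h => hst.ne (hs.trans h.symm)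
      simp [ht, hc]
    · by_cases ht : t = i.1
      · obtain rfl : s = _ := (adj_leaf_iff i.1 s).mp (ht ▸ hst.symm)
        simp [hs, hc]
      · simp [hs, ht]

/-- The twists attached to the branches and to the leaves. -/
noncomputable def twist : J ⊕ ({u : V // IsLeaf Γ u} × Bool) → Twist Γ :=
  Sum.elim B.conjTwist B.leafTwist

theorem commute_conj_conj {P Q : J} (hPQ : P ≠ Q) (m n : Multiplicative ℤ) :
    Commute ((B.conjTwist P).aut m) ((B.conjTwist Q).aut n) := by
  by_cases hg : B.gate P = B.gate Q
  · have hd := Set.disjoint_left.mp (B.disjoint_of_gate_eq P Q hg hPQ)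
    have hP : B.dir (B.gate Q) ∉ B.branch P := hg ▸ B.dir_notMem P
    have hQ : B.dir (B.gate Q) ∉ B.branch Q := B.dir_notMem Q
    apply Twist.commute_aut_of_fixed <;> simp [conjTwist, hP, hQ, hg]
  have nested : ∀ {P Q : J} (_ : B.gate Q ∈ B.branch P) (m n : Multiplicative ℤ),
      Commute ((B.conjTwist P).aut m) ((B.conjTwist Q).aut n) := by
    intro P Q h m n
    obtain ⟨hsub, hPQ⟩ := B.nested P Q h
    have hne : B.gate P ≠ B.gate Q := fun e => B.gate_notMem P (e ▸ h)
    have hxQ : B.dir (B.gate P) ∉ B.branch Q := fun hx => B.dir_notMem P (hsub hx)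
    rcases B.closed P _ _ h (B.adj_dir (B.gate Q)) with hx | hx
    · have hc := commute_raagGen (B.adj_dir (B.gate P))
      apply Twist.commute_aut_of_fixed <;>
        simp [conjTwist, hx, hxQ, B.gate_notMem P, hc.symm]
    · apply Twist.commute_aut_of_nested
      · simp [conjTwist, hxQ]
      · simp [conjTwist, hxQ]
      · simp [conjTwist, hx]
      · intro t
        by_cases ht : t ∈ B.branch Q
        · right; simp [conjTwist, hx, hsub ht]
        · left; simp [conjTwist, ht]
  by_cases h1 : B.gate Q ∈ B.branch P
  · exact nested h1 m n
  by_cases h2 : B.gate P ∈ B.branch Q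
  · exact (nested h2 n m).symm
  have hd := Set.disjoint_left.mp (B.disjoint_of_gate_ne P Q hg h1 h2)
  have hP : B.dir (B.gate Q) ∉ B.branch P := fun hx =>
    (B.closed P _ _ hx (B.adj_dir _).symm).elim (Ne.symm hg) h1
  have hQ : B.dir (B.gate P) ∉ B.branch Q := fun hx =>
    (B.closed Q _ _ hx (B.adj_dir _).symm).elim hg h2
  apply Twist.commute_aut_of_fixed
  iterate 4 simp [conjTwist, hP, hQ]
  intro t
  by_cases ht : t ∈ B.branch P
  · simp [conjTwist, hd ht]
  · simp [conjTwist, ht]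

theorem commute_conj_leaf (P : J) (i : {u : V // IsLeaf Γ u} × Bool) (m n : Multiplicative ℤ) :
    Commute ((B.conjTwist P).aut m) ((B.leafTwist i).aut n) := by
  have hadj : Γ.Adj i.1 (leafNbr Γ i.1) := (adj_leaf_iff _ _).mpr rfl
  have hx : B.dir (B.gate P) ≠ i.1 := fun h => B.dir_not_leaf (B.gate P) (h ▸ i.1.2)
  have hv : (i.1 : V) ≠ B.gate P := fun h => B.gate_not_leaf P (h ▸ i.1.2)
  by_cases hm : B.leafMult i ∈ B.branch P
  · have hu : (i.1 : V) ∈ B.branch P := by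
      have hw : leafNbr Γ i.1 ∈ B.branch P := by
        rcases B.leafMult_eq_or i with h | h
        · exact h ▸ hm
        · rw [h] at hm
          exact (B.closed P _ _ hm (B.adj_dir _).symm).resolve_left
            fun e => B.dir_notMem P (e ▸ hm)
      exact (B.closed P _ _ hw hadj.symm).resolve_left hv
    apply Twist.commute_aut_of_nested
    · simp [leafTwist]
    · simp [leafTwist, conjTwist, hx]
    · simp [leafTwist, conjTwist, hm]
    · intro t
      by_cases ht : t = i.1
      · right; simp [conjTwist, leafTwist, hm, hu, ht]
      · left; simp [leafTwist, ht]
  · apply Twist.commute_aut_of_fixed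
    · simp [leafTwist, conjTwist, hm]
    · simp [leafTwist, conjTwist, hm]
    · simp [leafTwist]
    · simp [leafTwist, conjTwist, hx]
    · intro t
      by_cases ht : t = i.1
      · subst ht
        by_cases hu : (i.1 : V) ∈ B.branch P
        · left
          change Commute (raagGen Γ (B.dir (B.gate P))) (raagGen Γ (B.leafMult i))
          have hc := commute_raagGen (B.adj_dir (B.gate P))
          rcases B.closed P _ _ hu hadj with hw | hw
          · rcases B.leafMult_eq_or i with h | h
            · rw [h, hw]; exact hc.symm
            · rw [h, hw]
          · rcases B.leafMult_eq_or i with h | h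
            · exact absurd (h ▸ hw) hm
            · rw [h] at hm ⊢
              rw [(B.closed P _ _ hw (B.adj_dir _)).resolve_right hm]
              exact hc.symm
        · right; left; simp [conjTwist, hu]
      · right; right; simp [leafTwist, ht]

theorem commute_leaf_leaf (i j : {u : V // IsLeaf Γ u} × Bool) (m n : Multiplicative ℤ) :
    Commute ((B.leafTwist i).aut m) ((B.leafTwist j).aut n) := by
  have hi : B.leafMult i ≠ j.1 := fun h => B.leafMult_not_leaf i (h ▸ j.1.2)
  have hj : B.leafMult j ≠ i.1 := fun h => B.leafMult_not_leaf j (h ▸ i.1.2)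
  apply Twist.commute_aut_of_fixed
  iterate 4 simp [leafTwist, hi, hj]
  intro t
  by_cases hti : t = i.1
  · by_cases htj : t = j.1
    · left
      have : i.1 = j.1 := Subtype.ext (hti.symm.trans htj)
      have h := B.commute_leafMult_leafMult i.1 i.2 j.2
      change Commute (raagGen Γ (B.leafMult (i.1, i.2))) (raagGen Γ (B.leafMult (j.1, j.2)))
      rwa [← this]
    · right; right; simp [leafTwist, htj]
  · right; left; simp [leafTwist, hti]

theorem commute_twist : Pairwise fun i j =>
    ∀ m n, Commute ((B.twist i).aut m) ((B.twist j).aut n) := by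
  rintro (P | i) (Q | j) h m n
  · exact B.commute_conj_conj (fun e => h (congrArg Sum.inl e)) m n
  · exact B.commute_conj_leaf P j m n
  · exact (B.commute_conj_leaf Q i n m).symm
  · exact B.commute_leaf_leaf i j m n

open Classical in
theorem detect_leaf (i : {u : V // IsLeaf Γ u} × Bool) :
    ∃ (G : Type) (_ : Group G) (ρ : RAAG Γ →* G) (R : Set (RAAG Γ →* G)), ρ ∈ R ∧
      (∀ j ≠ Sum.inr i, ∀ n, ∀ σ ∈ R, σ.comp ((B.twist j).aut n).toMonoidHom ∈ R) ∧
      ∀ σ ∈ R, ∀ n g, (∀ a, σ ((B.leafTwist i).aut n a) = ρ (g * a * g⁻¹)) → n = 1 := by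
  let ρ : RAAG Γ →* Multiplicative ℤ := raagLift Γ
    (fun t => if t = B.leafMult i then Multiplicative.ofAdd 1 else 1) fun _ _ _ => Commute.all _ _
  have hρ : ∀ t, ρ (raagGen Γ t) = if t = B.leafMult i then Multiplicative.ofAdd 1 else 1 :=
    fun t => raagLift_gen ..
  refine ⟨Multiplicative ℤ, inferInstance, ρ,
    {σ | ∀ t, (¬ IsLeaf Γ t ∨ t = i.1) → σ (raagGen Γ t) = ρ (raagGen Γ t)},
    fun _ _ => rfl, ?_, ?_⟩
  · rintro (P | j) hj n σ hσ t ht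
    · change σ ((B.conjTwist P).endo n.toAdd (raagGen Γ t)) = _
      rw [Twist.endo_gen, map_mul, map_mul, map_zpow, map_zpow, mul_right_comm, ← zpow_add,
        hσ t ht]
      by_cases h : t ∈ B.branch P <;> simp [conjTwist, h]
    · change σ ((B.leafTwist j).endo n.toAdd (raagGen Γ t)) = _
      rw [Twist.endo_gen, map_mul, map_mul, map_zpow, map_zpow, mul_right_comm, ← zpow_add,
        hσ t ht]
      by_cases h : t = j.1
      · have hti : t = i.1 := ht.resolve_left fun h' => h' (h ▸ j.1.2)
        have hij : i.1 = j.1 := Subtype.ext (hti.symm.trans h)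
        have hm : B.leafMult j ≠ B.leafMult i := by
          have : j.2 ≠ i.2 := fun e => hj (congrArg Sum.inr (Prod.ext hij.symm e))
          have := B.leafMult_ne i.1 this
          rwa [show (i.1, j.2) = j from Prod.ext hij rfl] at this
        have h1 : σ (raagGen Γ (B.leafMult j)) = 1 := by
          rw [hσ _ (Or.inl (B.leafMult_not_leaf j)), hρ, if_neg hm]
        simp [leafTwist, h1]
      · simp [leafTwist, h]
  · intro σ hσ n g h
    have h1 := h (raagGen Γ i.1)
    have hne : (i.1 : V) ≠ B.leafMult i := fun e => B.leafMult_not_leaf i (e ▸ i.1.2)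
    rw [Twist.aut_apply, Twist.endo_gen, map_mul, map_mul, map_zpow, map_zpow, map_mul, map_mul,
      map_inv, mul_inv_cancel_comm, hσ _ (Or.inr rfl), hρ] at h1
    simp only [leafTwist] at h1
    rw [hσ _ (Or.inl (B.leafMult_not_leaf i)), hρ] at h1
    apply Multiplicative.toAdd.injective
    simpa [hne, ← ofAdd_zsmul] using h1

open Classical in
theorem detect_conj (P : J) :
    ∃ (G : Type) (_ : Group G) (ρ : RAAG Γ →* G) (R : Set (RAAG Γ →* G)), ρ ∈ R ∧
      (∀ Q ≠ P, ∀ n, ∀ σ ∈ R, σ.comp ((B.conjTwist Q).aut n).toMonoidHom ∈ R) ∧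
      ∀ σ ∈ R, ∀ n g, (∀ a, σ ((B.conjTwist P).aut n a) = ρ (g * a * g⁻¹)) → n = 1 := by
  obtain ⟨c, -, hcx, hcadj, hc⟩ := B.exists_core (B.dir (B.gate P))
  set v := B.gate P with hv
  set x := B.dir v with hx
  set y := B.start P with hy
  have hyP : y ∈ B.branch P := B.start_mem P
  have hvy : Γ.Adj v y := B.adj_start P
  have hvx : Γ.Adj v x := B.adj_dir v
  have hxP : x ∉ B.branch P := B.dir_notMem P
  have hxy : ¬ Γ.Adj y x := fun h => (B.closed P y x hyP h).elim hvx.ne' hxP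
  have hyx : y ≠ x := fun h => hxP (h ▸ hyP)
  let b : DihedralGroup 0 := DihedralGroup.sr 0
  let f : V → DihedralGroup 0 := fun t =>
    if t = x then DihedralGroup.r 1 else if t = y ∨ t = c then b else 1
  have hf : ∀ s t, Γ.Adj s t → Commute (f s) (f t) := by
    intro s t hst
    by_cases hs : s = x
    · have h1 : t ≠ x := fun h => hst.ne (hs.trans h.symm)
      have h2 : t ≠ y := fun h => hxy (h ▸ hs ▸ hst.symm)
      have h3 : t ≠ c := fun h => hcadj (h ▸ hs ▸ hst.symm)
      simp [f, h1, h2, h3]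
    · by_cases ht : t = x
      · have h2 : s ≠ y := fun h => hxy (h ▸ ht ▸ hst)
        have h3 : s ≠ c := fun h => hcadj (h ▸ ht ▸ hst)
        simp [f, hs, h2, h3]
      · simp only [f, hs, ht, if_false]
        split_ifs <;> simp
  let ρ : RAAG Γ →* DihedralGroup 0 := raagLift Γ f hf
  have hρ : ∀ t, ρ (raagGen Γ t) = f t := fun t => raagLift_gen ..
  have hfx : f x = DihedralGroup.r 1 := if_pos rfl
  have hfy : f y = b := by simp [f, hyx]
  have hfc : f c = b := by simp [f, hcx]
  have hf1 : ∀ t, t ≠ x → t ≠ y → t ≠ c → f t = 1 := by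
    intro t h1 h2 h3
    simp [f, h1, h2, h3]
  refine ⟨DihedralGroup 0, inferInstance, ρ,
    {σ | ∃ M : ℤ, ∀ t, σ (raagGen Γ t) = b ^ M * f t * b ^ (-M)}, ⟨0, fun t => by simp [hρ]⟩,
    ?_, ?_⟩
  · rintro Q hQ n σ ⟨M, hσ⟩
    set z := B.dir (B.gate Q) with hz
    have hendo : ∀ t, σ ((B.conjTwist Q).aut n (raagGen Γ t)) = b ^ M *
        (if t ∈ B.branch Q then f z ^ n.toAdd * f t * f z ^ (-n.toAdd) else f t) * b ^ (-M) := by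
      intro t
      rw [Twist.aut_apply, Twist.endo_gen]
      split_ifs with h
      · simp only [conjTwist, h, if_true, mul_one, mul_neg, ← hz]
        rw [map_mul, map_mul, map_zpow, map_zpow, hσ, hσ]
        simp only [zpow_neg, conj_zpow]
        group
      · simp [conjTwist, h, hσ]
    have trivial_of : (∀ t, t ∈ B.branch Q → f z ^ n.toAdd * f t * f z ^ (-n.toAdd) = f t) →
        ∃ M : ℤ, ∀ t, σ ((B.conjTwist Q).aut n (raagGen Γ t)) = b ^ M * f t * b ^ (-M) := by
      intro h
      refine ⟨M, fun t => ?_⟩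
      rw [hendo]
      split_ifs with ht
      · rw [h t ht]
      · rfl
    change ∃ M : ℤ, ∀ t, σ ((B.conjTwist Q).aut n (raagGen Γ t)) = b ^ M * f t * b ^ (-M)
    have hyQ_of_gate : B.gate P = B.gate Q → y ∉ B.branch Q := fun e h =>
      Set.disjoint_left.mp (B.disjoint_of_gate_eq P Q e (Ne.symm hQ)) hyP h
    have hv_of_y : y ∈ B.branch Q → v ∈ B.branch Q := fun h =>
      (B.closed Q y v h hvy.symm).resolve_left fun e => hyQ_of_gate e h
    have hxQ_of_gate : B.gate P = B.gate Q → x ∉ B.branch Q := fun e h =>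
      B.dir_notMem Q (e ▸ h)
    have hv_of_x : x ∈ B.branch Q → v ∈ B.branch Q := fun h =>
      (B.closed Q x v h hvx.symm).resolve_left fun e => hxQ_of_gate e h
    have hzQ : z ∉ B.branch Q := B.dir_notMem Q
    have hzg : Γ.Adj (B.gate Q) z := B.adj_dir _
    by_cases hzx : z = x
    · have hxQ : x ∉ B.branch Q := hzx ▸ hzQ
      have hyQ : y ∉ B.branch Q := fun h =>
        (B.closed Q v x (hv_of_y h) hvx).elim (fun e => hzg.ne (e.symm.trans hzx.symm)) hxQ
      refine trivial_of fun t ht => ?_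
      rw [hf1 t (fun e => hxQ (e ▸ ht)) (fun e => hyQ (e ▸ ht)) (fun e => hc Q (e ▸ ht))]
      simp
    by_cases hzy : z = y
    · have hyQ : y ∉ B.branch Q := hzy ▸ hzQ
      have hxQ : x ∉ B.branch Q := fun h =>
        (B.closed Q v y (hv_of_x h) hvy).elim (fun e => hzg.ne (e.symm.trans hzy.symm)) hyQ
      refine trivial_of fun t ht => ?_
      rw [hf1 t (fun e => hxQ (e ▸ ht)) (fun e => hyQ (e ▸ ht)) (fun e => hc Q (e ▸ ht))]
      simp
    by_cases hzc : z = c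
    · have hx_of_y : y ∈ B.branch Q → x ∈ B.branch Q := fun h =>
        (B.closed Q v x (hv_of_y h) hvx).resolve_left fun e => hcadj (hzc ▸ e ▸ hzg.symm)
      have hy_of_x : x ∈ B.branch Q → y ∈ B.branch Q := fun h =>
        (B.closed Q v y (hv_of_x h) hvy).resolve_left fun e => by
          rcases B.closed P y c hyP (hzc ▸ e ▸ hzg) with h1 | h1
          · exact hcadj (h1 ▸ hvx)
          · exact hc P h1
      by_cases hxQ : x ∈ B.branch Q
      · have hyQ := hy_of_x hxQ
        refine ⟨M + n.toAdd, fun t => ?_⟩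
        rw [hendo, hzc, hfc]
        split_ifs with ht
        · group
        · have : f t = b ∨ f t = 1 := by
            by_cases h : t = c
            · exact Or.inl (h ▸ hfc)
            · exact Or.inr (hf1 t (fun e => ht (e ▸ hxQ)) (fun e => ht (e ▸ hyQ)) h)
          rcases this with h | h <;> rw [h] <;> group
      · have hyQ : y ∉ B.branch Q := fun h => hxQ (hx_of_y h)
        refine trivial_of fun t ht => ?_
        rw [hf1 t (fun e => hxQ (e ▸ ht)) (fun e => hyQ (e ▸ ht)) (fun e => hc Q (e ▸ ht))]
        simp
    · refine trivial_of fun t ht => ?_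
      rw [hf1 z hzx hzy hzc]
      simp
  · rintro σ ⟨M, hσ⟩ n g h
    have h1 := h (raagGen Γ c)
    have h2 := h (raagGen Γ y)
    simp only [Twist.aut_apply, Twist.endo_gen, map_mul, map_zpow, map_inv, hσ, hρ] at h1 h2
    simp only [conjTwist, hc P, hyP, ← hv, ← hx, hfx, hfy, hfc, if_true, if_false, mul_zero,
      zpow_zero, one_mul, mul_one, mul_neg] at h1 h2
    rw [← h1] at h2
    simp only [conj_zpow, zpow_neg] at h2
    have h3 : (DihedralGroup.r 1 : DihedralGroup 0) ^ n.toAdd * b *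
        ((DihedralGroup.r 1) ^ n.toAdd)⁻¹ = b := by
      have := congrArg (fun w => (b ^ M)⁻¹ * w * b ^ M) h2
      simpa [mul_assoc] using this
    rw [DihedralGroup.r_zpow] at h3
    simpa [b] using h3

/-- The twists of a branch system generate a free abelian group of outer automorphisms. -/
theorem hasFreeAbelianSubgroupOfRank [Fintype V] [Finite J] (B : BranchSystem Γ J) {r : ℕ}
    (hr : r ≤ Nat.card J + 2 * numLeaves Γ) :
    HasFreeAbelianSubgroupOfRank (OutG (RAAG Γ)) r := by
  classical
  have := Fintype.ofFinite J
  refine hasFreeAbelianSubgroupOfRank_outG (ι := J ⊕ ({u : V // IsLeaf Γ u} × Bool)) ?_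
    (fun i => (B.twist i).aut) B.commute_twist (Sum.elim (fun _ => 1) (fun _ => 0)) ?_
  · have h : Fintype.card {u : V // IsLeaf Γ u} = numLeaves Γ := by
      rw [← Nat.card_eq_fintype_card]
      rfl
    rw [Fintype.card_sum, Fintype.card_prod, Fintype.card_bool, h, ← Nat.card_eq_fintype_card]
    omega
  · rintro (P | i)
    · obtain ⟨G, hG, ρ, R, h1, h2, h3⟩ := B.detect_conj P
      refine ⟨G, hG, ρ, R, h1, ?_, h3⟩
      rintro (Q | j) hj hrk
      · exact h2 Q fun e => hj (e ▸ rfl)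
      · simp at hrk
    · obtain ⟨G, hG, ρ, R, h1, h2, h3⟩ := B.detect_leaf i
      exact ⟨G, hG, ρ, R, h1, fun j hj _ => h2 j hj, h3⟩

end BranchSystem

section Graph

variable {V : Type*} {Γ : SimpleGraph V}

theorem not_isLeaf_of_adj_of_adj {c a b : V} (ha : Γ.Adj c a) (hb : Γ.Adj c b) (hab : a ≠ b) :
    ¬ IsLeaf Γ c := fun h => by
  obtain ⟨w, hw⟩ := h.exists_adj
  exact hab (((hw a).mp ha).trans ((hw b).mp hb).symm)

theorem not_isLeaf_of_mem_cycle {u c : V} {p : Γ.Walk u u} (hp : p.IsCycle) (hc : c ∈ p.support) :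
    ¬ IsLeaf Γ c := fun h => by
  have h2 := hp.ncard_neighborSet_toSubgraph_eq_two hc
  have h3 := Set.ncard_le_ncard (p.toSubgraph.neighborSet_subset c)
    (Set.finite_of_ncard_ne_zero (by rw [show _ = 1 from h]; simp))
  rw [h2, show _ = 1 from h] at h3
  omega

theorem not_triangle (hgirth : ∀ (v : V) (c : Γ.Walk v v), c.IsCycle → 5 ≤ c.length) {a b c : V}
    (hab : Γ.Adj a b) (hbc : Γ.Adj b c) (hca : Γ.Adj c a) : False := by
  have := hgirth a (.cons hab (.cons hbc (.cons hca .nil))) (by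
    simp [SimpleGraph.Walk.cons_isCycle_iff, hab.ne, hbc.ne, hca.ne, hab.ne', hca.ne'])
  simp at this

theorem ReachAvoid.mem_of_closed {v a b : V} (h : ReachAvoid Γ v a b) {S : Set V}
    (hS : ∀ c d, c ∈ S → Γ.Adj c d → d ≠ v → d ∈ S) (ha : a ∈ S) : b ∈ S := by
  obtain ⟨p, hp⟩ := h
  induction p with
  | nil => exact ha
  | cons hadj p ih =>
    rw [SimpleGraph.Walk.support_cons, List.mem_cons, not_or] at hp
    exact ih (hS _ _ ha hadj fun e => hp.2 (e ▸ p.start_mem_support)) hp.2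

theorem ReachAvoid.symm {v a b : V} (h : ReachAvoid Γ v a b) : ReachAvoid Γ v b a := by
  obtain ⟨p, hp⟩ := h
  exact ⟨p.reverse, by simpa using hp⟩

theorem ReachAvoid.trans {v a b c : V} (h : ReachAvoid Γ v a b) (h' : ReachAvoid Γ v b c) :
    ReachAvoid Γ v a c := by
  obtain ⟨p, hp⟩ := h
  obtain ⟨q, hq⟩ := h'
  exact ⟨p.append q, by simp [SimpleGraph.Walk.mem_support_append_iff, hp, hq]⟩

theorem ReachAvoid.ne_right {v a b : V} (h : ReachAvoid Γ v a b) : b ≠ v := by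
  obtain ⟨p, hp⟩ := h
  exact fun e => hp (e ▸ p.end_mem_support)

theorem reachAvoid_refl {v a : V} (h : a ≠ v) : ReachAvoid Γ v a a :=
  ⟨.nil, by simpa using h.symm⟩

theorem reachAvoid_of_adj {v a b : V} (h : Γ.Adj a b) (ha : a ≠ v) (hb : b ≠ v) :
    ReachAvoid Γ v a b :=
  ⟨.cons h .nil, by simp [ha.symm, hb.symm]⟩

/-- Deleting a vertex from a path leaves every other vertex connected to one of the endpoints. -/
theorem SimpleGraph.Walk.IsPath.reachAvoid {s r c v : V} {p : Γ.Walk s r} (hp : p.IsPath)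
    (hc : c ∈ p.support) (hcv : c ≠ v) : ReachAvoid Γ v c s ∨ ReachAvoid Γ v c r := by
  classical
  by_cases h1 : v ∈ (p.takeUntil c hc).support
  · right
    refine ⟨p.dropUntil c hc, fun h2 => ?_⟩
    have hnd := hp.support_nodup
    rw [← p.take_spec hc, SimpleGraph.Walk.support_append] at hnd
    rw [SimpleGraph.Walk.mem_support_iff] at h2
    exact List.disjoint_of_nodup_append hnd h1 (h2.resolve_left hcv.symm)
  · left
    exact ReachAvoid.symm ⟨_, h1⟩

/-- Adjacent vertices with a neighbor for each vertex pointing towards them. -/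
theorem exists_dir (hconn : Γ.Connected) {r s : V} (hrs : Γ.Adj r s) (w : V) :
    ∃ d, Γ.Adj w d ∧ (w = r ∧ d = s ∨ w ≠ r ∧ ReachAvoid Γ w d r) := by
  by_cases h : w = r
  · exact ⟨s, h ▸ hrs, Or.inl ⟨h, rfl⟩⟩
  · obtain ⟨p, hp⟩ := hconn.exists_isPath w r
    cases p with
    | nil => exact absurd rfl h
    | cons hadj q =>
      rw [SimpleGraph.Walk.cons_isPath_iff] at hp
      exact ⟨_, hadj, Or.inr ⟨h, q, hp.2⟩⟩

theorem exists_branchSystem (hconn : Γ.Connected)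
    (hgirth : ∀ (v : V) (c : Γ.Walk v v), c.IsCycle → 5 ≤ c.length)
    {r s : V} (hrs : Γ.Adj r s) (p : Γ.Walk s r) (hcyc : (SimpleGraph.Walk.cons hrs p).IsCycle)
    {J : Type*} (v y : J → V) (hadj : ∀ P, Γ.Adj (v P) (y P))
    (hr : ∀ P, v P ≠ r → ¬ ReachAvoid Γ (v P) (y P) r)
    (hs : ∀ P, v P = r → ¬ ReachAvoid Γ (v P) (y P) s)
    (hdis : ∀ P Q, v P = v Q → P ≠ Q → ¬ ReachAvoid Γ (v P) (y P) (y Q)) :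
    Nonempty (BranchSystem Γ J) := by
  choose dir hdir hdir' using exists_dir hconn hrs
  let C : J → Set V := fun P => {t | ReachAvoid Γ (v P) (y P) t}
  have closed : ∀ P a b, a ∈ C P → Γ.Adj a b → b = v P ∨ b ∈ C P := by
    intro P a b ha hab
    by_cases hb : b = v P
    · exact Or.inl hb
    · exact Or.inr (ReachAvoid.trans ha (reachAvoid_of_adj hab (ReachAvoid.ne_right ha) hb))
  have gate_notMem : ∀ P, v P ∉ C P := fun P h => ReachAvoid.ne_right h rfl
  have start_mem : ∀ P, y P ∈ C P := fun P => reachAvoid_refl (hadj P).ne'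
  have hrC : ∀ P, r ∉ C P := by
    intro P
    by_cases h : v P = r
    · exact h ▸ gate_notMem P
    · exact hr P h
  have hsC : ∀ P, s ∉ C P := by
    intro P h
    by_cases e : v P = r
    · exact hs P e h
    · exact (closed P s r h hrs.symm).elim (Ne.symm e) (hrC P)
  have core : ∀ c ∈ p.support, ∀ P, c ∉ C P := by
    intro c hc P hcP
    rcases ((SimpleGraph.Walk.cons_isCycle_iff _ _).mp hcyc).1.reachAvoid hc
      (ReachAvoid.ne_right hcP) with h | h
    · exact hsC P (ReachAvoid.trans hcP h)
    · exact hrC P (ReachAvoid.trans hcP h)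
  have dir_notMem : ∀ P, dir (v P) ∉ C P := by
    intro P h
    rcases hdir' (v P) with ⟨-, h2⟩ | ⟨-, h2⟩
    · exact hsC P (h2 ▸ h)
    · exact hrC P (ReachAvoid.trans h h2)
  have core_not_leaf : ∀ c ∈ p.support, ¬ IsLeaf Γ c := fun c hc =>
    not_isLeaf_of_mem_cycle hcyc (by simp [hc])
  have dir_not_leaf : ∀ w, ¬ IsLeaf Γ (dir w) := by
    intro w
    rcases hdir' w with ⟨-, h2⟩ | ⟨-, q, hq⟩
    · exact h2 ▸ core_not_leaf s p.start_mem_support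
    · generalize he : dir w = d at q hq
      cases q with
      | nil => exact core_not_leaf r p.end_mem_support
      | cons h q' =>
        refine not_isLeaf_of_adj_of_adj (he ▸ (hdir w).symm) h fun e => ?_
        subst e
        simp at hq
  have nested : ∀ P Q, v Q ∈ C P → C Q ⊆ C P ∧ v P ∉ C Q := by
    intro P Q h
    have hPQ : v P ∉ C Q := by
      intro h'
      obtain ⟨q⟩ := hconn.preconnected (y P) r
      have hmem : ∀ {a b : V} (q : Γ.Walk a b), a ∈ C P ∪ C Q → b ∈ C P ∪ C Q := by
        intro a b q
        induction q with
        | nil => exact id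
        | cons hab q ih =>
          rintro (ha | ha)
          · exact ih ((closed P _ _ ha hab).elim (fun e => Or.inr (e ▸ h')) Or.inl)
          · exact ih ((closed Q _ _ ha hab).elim (fun e => Or.inl (e ▸ h)) Or.inr)
      exact (hmem q (Or.inl (start_mem P))).elim (hrC P) (hrC Q)
    refine ⟨fun t ht => ?_, hPQ⟩
    refine (ReachAvoid.mem_of_closed ht (S := C P ∩ C Q) ?_ ⟨?_, start_mem Q⟩).1
    · rintro c d ⟨hcP, hcQ⟩ hcd hd
      have hdQ := (closed Q c d hcQ hcd).resolve_left hd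
      exact ⟨(closed P c d hcP hcd).resolve_left fun e => hPQ (e ▸ hdQ), hdQ⟩
    · exact (closed P _ _ h (hadj Q)).resolve_left fun e => hPQ (e ▸ start_mem Q)
  have path := ((SimpleGraph.Walk.cons_isCycle_iff _ _).mp hcyc).1
  have hlen := hgirth _ _ hcyc
  rw [SimpleGraph.Walk.length_cons] at hlen
  refine ⟨⟨v, y, C, dir, closed, gate_notMem, start_mem, hadj, hdir, dir_notMem, ?_, ?_, nested,
    ?_, dir_not_leaf, ?_, ?_⟩⟩
  · refine fun P Q e hne => Set.disjoint_left.mpr fun t hP hQ => hdis P Q e hne ?_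
    exact ReachAvoid.trans hP (ReachAvoid.symm (e ▸ hQ))
  · refine fun P Q hne hQP hPQ => Set.disjoint_left.mpr fun t hP hQ => ?_
    have hmem := (ReachAvoid.mem_of_closed (ReachAvoid.symm hP) (S := C P ∩ C Q) ?_ ⟨hP, hQ⟩).2
    · exact (closed Q _ _ hmem (hadj P).symm).elim hne hPQ
    · rintro c d ⟨hcP, hcQ⟩ hcd hd
      have hdP := (closed P c d hcP hcd).resolve_left hd
      exact ⟨hdP, (closed Q c d hcQ hcd).resolve_left fun e => hQP (e ▸ hdP)⟩
  · intro P
    exact not_isLeaf_of_adj_of_adj (hadj P) (hdir _) fun e => dir_notMem P (e ▸ start_mem P)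
  · intro u w hu huw hw
    obtain ⟨d, hd⟩ := hu.exists_adj
    obtain ⟨e, he⟩ := hw.exists_adj
    obtain ⟨q⟩ := hconn.preconnected u r
    have hmem : ∀ {a b : V} (q : Γ.Walk a b), a = u ∨ a = w → b = u ∨ b = w := by
      intro a b q
      induction q with
      | nil => exact id
      | cons h q ih =>
        rintro (rfl | rfl)
        · exact ih (Or.inr (((hd _).mp h).trans ((hd _).mp huw).symm))
        · exact ih (Or.inl (((he _).mp h).trans ((he _).mp huw.symm).symm))
    rcases hmem q (Or.inl rfl) with h | h
    · exact core_not_leaf r p.end_mem_support (h ▸ hu)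
    · exact core_not_leaf r p.end_mem_support (h ▸ hw)
  · intro x
    have edge : ∀ a b, a ∈ p.support → b ∈ p.support → Γ.Adj a b → a ≠ x → b ≠ x →
        ∃ c, ¬ IsLeaf Γ c ∧ c ≠ x ∧ ¬ Γ.Adj c x ∧ ∀ P, c ∉ C P := by
      intro a b ha hb hab hax hbx
      by_cases h : Γ.Adj a x
      · exact ⟨b, core_not_leaf b hb, hbx, fun h' => not_triangle hgirth hab h' h.symm, core b hb⟩
      · exact ⟨a, core_not_leaf a ha, hax, h, core a ha⟩
    by_cases hx : x = r ∨ x = s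
    · have hinj := path.getVert_injOn
      refine edge (p.getVert 1) (p.getVert 2) (p.getVert_mem_support 1) (p.getVert_mem_support 2)
        (p.adj_getVert_succ (by omega)) ?_ ?_
      all_goals
        intro e
        rcases hx with h | h
        · have e' := e.trans (h.trans p.getVert_length.symm)
          have := hinj (by simp; omega) (by simp) e'
          omega
        · have e' := e.trans (h.trans p.getVert_zero.symm)
          have := hinj (by simp; omega) (by simp) e'
          omega
    · rw [not_or] at hx
      exact edge r s p.end_mem_support p.start_mem_support hrs (Ne.symm hx.1) (Ne.symm hx.2)

theorem NoCutVertex.sup {H K : Γ.Subgraph} (hH : H.Connected) (hK : K.Connected)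
    (hH' : NoCutVertex H) (hK' : NoCutVertex K) {a b : V} (hab : a ≠ b)
    (ha : a ∈ H.verts ∩ K.verts) (hb : b ∈ H.verts ∩ K.verts) : NoCutVertex (H ⊔ K) := by
  intro t _
  have del : ∀ {L : Γ.Subgraph}, L.Connected → NoCutVertex L → (L.deleteVerts {t}).Connected := by
    intro L hL hL'
    by_cases ht : t ∈ L.verts
    · exact hL' t ht
    · rwa [← SimpleGraph.Subgraph.deleteVerts_inter_verts_left_eq,
        Set.inter_singleton_eq_empty.mpr ht, SimpleGraph.Subgraph.deleteVerts_empty]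
  have h := SimpleGraph.Subgraph.connected_sup (del hH hH').preconnected (del hK hK').preconnected
    (by
      by_cases hat : a = t
      · exact ⟨b, ⟨hb.1, fun e => hab (hat.trans e.symm)⟩, ⟨hb.2, fun e => hab (hat.trans e.symm)⟩⟩
      · exact ⟨a, ⟨ha.1, hat⟩, ⟨ha.2, hat⟩⟩)
  refine h.mono ?_ ?_
  · refine sup_le ?_ ?_ <;> apply SimpleGraph.Subgraph.deleteVerts_mono <;> simp
  · ext z
    simp [or_and_right]

theorem IsPiece.adj_of_le {P H : Γ.Subgraph} (hP : IsPiece Γ P) (hH : H.Connected)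
    (hH' : NoCutVertex H) {a b : V} (hab : P.Adj a b) (hab' : H.Adj a b) : H ≤ P := by
  have h := hP.2.2.2 (P ⊔ H)
    (SimpleGraph.Subgraph.connected_sup hP.1.preconnected hH.preconnected
      ⟨a, hab.fst_mem, hab'.fst_mem⟩)
    (hP.2.1.mono (SimpleGraph.Subgraph.edgeSet_mono le_sup_left))
    (NoCutVertex.sup hP.1 hH hP.2.2.1 hH' hab.ne ⟨hab.fst_mem, hab'.fst_mem⟩
      ⟨hab.snd_mem, hab'.snd_mem⟩) le_sup_left
  exact le_sup_right.trans h.le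

theorem IsPiece.eq_of_adj {P Q : Γ.Subgraph} (hP : IsPiece Γ P) (hQ : IsPiece Γ Q) {a b : V}
    (hab : P.Adj a b) (hab' : Q.Adj a b) : P = Q :=
  le_antisymm (hQ.adj_of_le hP.1 hP.2.2.1 hab' hab) (hP.adj_of_le hQ.1 hQ.2.2.1 hab hab')

theorem SimpleGraph.Walk.IsCycle.noCutVertex {u : V} {c : Γ.Walk u u} (hc : c.IsCycle) :
    NoCutVertex c.toSubgraph := by
  classical
  intro t ht
  rw [SimpleGraph.Walk.mem_verts_toSubgraph] at ht
  rw [← c.toSubgraph_rotate ht]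
  have hr := hc.rotate ht
  generalize c.rotate t ht = d at hr
  cases d with
  | nil => exact absurd hr SimpleGraph.Walk.not_isCycle_nil
  | cons h q =>
  have hq := ((SimpleGraph.Walk.cons_isCycle_iff _ _).mp hr).1.reverse
  rw [SimpleGraph.Walk.toSubgraph, ← SimpleGraph.Walk.toSubgraph_reverse]
  generalize q.reverse = q' at hq
  cases q' with
  | nil => exact absurd h (Γ.loopless.irrefl _)
  | cons k m =>
  rw [SimpleGraph.Walk.cons_isPath_iff] at hq
  have hne : ∀ z ∈ m.support, z ≠ t := fun z hz e => hq.2 (e ▸ hz)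
  have hmt := m.end_mem_support
  have hms := m.start_mem_support
  refine m.toSubgraph_connected.mono ⟨?_, ?_⟩ ?_
  · intro z hz
    rw [SimpleGraph.Walk.mem_verts_toSubgraph] at hz
    simp [hne z hz, hz]
  · intro a b hab
    have ha := hne a (m.mem_verts_toSubgraph.mp hab.fst_mem)
    have hb := hne b (m.mem_verts_toSubgraph.mp hab.snd_mem)
    have ha' := m.mem_verts_toSubgraph.mp hab.fst_mem
    have hb' := m.mem_verts_toSubgraph.mp hab.snd_mem
    simp [ha, hb, ha', hb', hab]
  · ext z
    simp
    grind

/-- A piece containing the edge `vy` contains every edge `vz` with `z` in the component of `y`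
in the complement of `v`. -/
theorem IsPiece.adj_of_reachAvoid {P : Γ.Subgraph} (hP : IsPiece Γ P) {v y z : V}
    (hy : P.Adj v y) (hz : Γ.Adj v z) (h : ReachAvoid Γ v y z) : P.Adj v z := by
  classical
  by_cases hyz : y = z
  · exact hyz ▸ hy
  obtain ⟨q, hq⟩ := h
  have hb := q.bypass_isPath
  have hvb : v ∉ q.bypass.support := fun h => hq (q.support_bypass_subset_support h)
  generalize q.bypass = q at hb hvb
  have hcyc : (SimpleGraph.Walk.cons hz.symm (.cons hy.adj_sub q)).IsCycle := by
    rw [SimpleGraph.Walk.cons_isCycle_iff]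
    refine ⟨hb.cons hvb, ?_⟩
    rw [SimpleGraph.Walk.edges_cons, List.mem_cons, not_or]
    refine ⟨?_, fun h => hvb (q.snd_mem_support_of_mem_edges h)⟩
    simp [Ne.symm hyz, hz.ne']
  have hle := hP.adj_of_le (SimpleGraph.Walk.toSubgraph_connected _) hcyc.noCutVertex hy
    (by simp)
  exact (hle.2 (v := z) (w := v) (by simp)).symm

theorem IsPiece.exists_gate {P : Γ.Subgraph} (hP : IsPiece Γ P) (hconn : Γ.Connected) {r s : V}
    (hrs : Γ.Adj r s) (hPrs : ¬ P.Adj r s) : ∃ v y, P.Adj v y ∧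
      (v ≠ r → ¬ ReachAvoid Γ v y r) ∧ (v = r → ¬ ReachAvoid Γ v y s) := by
  obtain ⟨v, hv, hmin⟩ : ∃ v ∈ P.verts, ∀ w ∈ P.verts, Γ.dist v r ≤ Γ.dist w r := by
    obtain ⟨v, hv⟩ := hP.1.nonempty
    have h := Function.argminOn_mem (fun w => Γ.dist w r) P.verts ⟨v, hv⟩
    exact ⟨_, h, fun w hw => Function.argminOn_le (fun w => Γ.dist w r) P.verts hw⟩
  obtain ⟨y, hy⟩ : ∃ y, P.Adj v y := by
    have : Nontrivial P.verts := by
      obtain ⟨e, he⟩ := hP.2.1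
      induction e with
      | _ a b => exact ⟨⟨a, he.fst_mem⟩, ⟨b, he.snd_mem⟩, fun e => he.ne (congrArg Subtype.val e)⟩
    exact hP.1.preconnected.exists_adj_of_nontrivial ⟨v, hv⟩
  refine ⟨v, y, hy, fun hvr hreach => ?_, ?_⟩
  · obtain ⟨q, hq, hlen⟩ := hconn.exists_path_of_dist v r
    cases q with
    | nil => exact hvr rfl
    | @cons _ z _ hz q =>
      rw [SimpleGraph.Walk.cons_isPath_iff] at hq
      have hPz := hP.adj_of_reachAvoid hy hz (hreach.trans (ReachAvoid.symm ⟨q, hq.2⟩))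
      have h1 := hmin z hPz.snd_mem
      have h2 := SimpleGraph.dist_le q
      rw [SimpleGraph.Walk.length_cons] at hlen
      omega
  · rintro rfl hreach
    exact hPrs (hP.adj_of_reachAvoid hy hrs hreach)

end Graph

/-- Let `Γ` be a finite connected simple graph containing no
cycles of length 3 or 4 (every cycle has length ≥ 5) which is not a tree, with
`ℓ` leaves and `π` pieces.  Then `Out(A_Γ)` contains a free abelian subgroup
of rank `π + 2ℓ - 1`. -/
theorem out_raag_lower_bound_no_short_cycles
    {V : Type*} [Fintype V] (Γ : SimpleGraph V)
    (hconn : Γ.Connected)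
    (hgirth : ∀ (v : V) (c : Γ.Walk v v), c.IsCycle → 5 ≤ c.length)
    (hnottree : ¬ Γ.IsTree) :
    HasFreeAbelianSubgroupOfRank (OutG (RAAG Γ))
      (numPieces Γ + 2 * numLeaves Γ - 1) := by
  obtain ⟨r, c, hc⟩ : ∃ (r : V) (c : Γ.Walk r r), c.IsCycle := by
    by_contra! h
    exact hnottree ⟨hconn, fun v c => h v c⟩
  cases c with
  | nil => exact absurd hc SimpleGraph.Walk.not_isCycle_nil
  | @cons _ s _ hrs p =>
  let J := {P : Γ.Subgraph | IsPiece Γ P ∧ ¬ P.Adj r s}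
  choose v y hadj hr hs using fun P : J => P.2.1.exists_gate hconn hrs P.2.2
  obtain ⟨B⟩ := exists_branchSystem hconn hgirth hrs p hc v y (fun P => (hadj P).adj_sub) hr hs <| by
    intro P Q e hne h
    refine hne (Subtype.ext (P.2.1.eq_of_adj Q.2.1 (b := y Q) ?_ (hadj Q)))
    rw [← e]
    exact P.2.1.adj_of_reachAvoid (hadj P) (e ▸ (hadj Q).adj_sub) h
  refine B.hasFreeAbelianSubgroupOfRank ?_
  have h1 : numPieces Γ ≤ J.ncard + {P : Γ.Subgraph | IsPiece Γ P ∧ P.Adj r s}.ncard := by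
    refine (Set.ncard_le_ncard fun P hP => ?_).trans (Set.ncard_union_le _ _)
    by_cases h : P.Adj r s
    · exact Or.inr ⟨hP, h⟩
    · exact Or.inl ⟨hP, h⟩
  have h2 : {P : Γ.Subgraph | IsPiece Γ P ∧ P.Adj r s}.ncard ≤ 1 :=
    (Set.ncard_le_one_iff (Set.toFinite _)).mpr fun {P Q} hP hQ => hP.1.eq_of_adj hQ.1 hP.2 hQ.2
  have h3 : Nat.card J = J.ncard := rfl
  omega
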